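/- arXiv:cond-mat/0607615 — 3 statements merged into one kernel-verified Lean document; each statement's English description precedes it below -/
import Mathlib

section
/- For every integer M ≥ 1, the quenched pressure α_M is differentiable on ℝ and its derivative is α_M'(β) = β(1 − ⟨q̃_{12}²⟩_β), where ⟨q̃_{12}²⟩_β is the quenched two-replica Gibbs average of the squared overlap. -/
open MeasureTheory ProbabilityTheory

noncomputable section

/-- spin value of a Boolean configuration coordinate: `±1`. -/
def spinval (b : Bool) : ℝ := if b then 1 else -1

/-- Boltzmann weight of a configuration `τ`. -/
def boltzW (M : ℕ) (β : ℝ) (J : (Fin M × Fin M) → ℝ) (τ : Fin M → Bool) : ℝ :=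
  Real.exp ((β / Real.sqrt M) *
    ∑ k : Fin M, ∑ l : Fin M, J (k, l) * spinval (τ k) * spinval (τ l))

/-- Partition function of the mean-field model with full-double-sum Gaussian couplings. -/
def ZSK (M : ℕ) (β : ℝ) (J : (Fin M × Fin M) → ℝ) : ℝ :=
  ∑ τ : Fin M → Bool, boltzW M β J τ

/-- i.i.d. standard Gaussian couplings `(J_{kl})_{1≤k,l≤M}`. -/
def couplingLaw (M : ℕ) : Measure ((Fin M × Fin M) → ℝ) :=
  Measure.pi fun _ : Fin M × Fin M => gaussianReal 0 1

/-- Quenched pressure `α_M(β) = (1/M) E[ln Z_M(β;J)]`. -/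
def quenchedPressure (M : ℕ) (β : ℝ) : ℝ :=
  (1 / (M : ℝ)) * ∫ J, Real.log (ZSK M β J) ∂(couplingLaw M)

/-- Overlap of two configurations. -/
def qtilde (M : ℕ) (τ τ' : Fin M → Bool) : ℝ :=
  (1 / (M : ℝ)) * ∑ k : Fin M, spinval (τ k) * spinval (τ' k)

/-- Quenched two-replica Gibbs average `⟨q̃₁₂²⟩_β` of the squared overlap. -/
def avgQsq (M : ℕ) (β : ℝ) : ℝ :=
  ∫ J, (∑ τ₁ : Fin M → Bool, ∑ τ₂ : Fin M → Bool,
      boltzW M β J τ₁ * boltzW M β J τ₂ * (qtilde M τ₁ τ₂) ^ 2) / (ZSK M β J) ^ 2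
    ∂(couplingLaw M)

/-- Gaussian integration by parts on the real line. -/
lemma integral_id_mul_gaussianReal {f f' : ℝ → ℝ} {C C' : ℝ} (hf' : Continuous f')
    (hC : ∀ x, |f x| ≤ C) (hC' : ∀ x, |f' x| ≤ C') (hd : ∀ x, HasDerivAt f (f' x) x) :
    ∫ x, x * f x ∂gaussianReal 0 1 = ∫ x, f' x ∂gaussianReal 0 1 := by
  have hf : Continuous f := continuous_iff_continuousAt.2 fun x => (hd x).continuousAt
  have hpdf (x : ℝ) : HasDerivAt (gaussianPDFReal 0 1) (-(x * gaussianPDFReal 0 1 x)) x := by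
    rw [gaussianPDFReal_def]
    have h1 : HasDerivAt (fun x : ℝ => -(x - 0) ^ 2 / (2 * ((1 : NNReal) : ℝ))) (-x) x := by
      have := (((hasDerivAt_id' x).sub_const 0).pow 2).neg.div_const (2 * ((1 : NNReal) : ℝ))
      refine this.congr_deriv ?_
      simp
      ring
    refine (h1.exp.const_mul (Real.sqrt (2 * Real.pi * ((1 : NNReal) : ℝ)))⁻¹).congr_deriv ?_
    ring
  have hint := integrable_gaussianPDFReal 0 1
  have hint' : Integrable (fun x => -(x * gaussianPDFReal 0 1 x)) := by
    have := ((integrable_mul_exp_neg_mul_sq (b := 1 / 2) (by norm_num)).const_mul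
      (Real.sqrt (2 * Real.pi * ((1 : NNReal) : ℝ)))⁻¹).neg
    refine this.congr (.of_forall fun x => ?_)
    simp only [gaussianPDFReal_def, Pi.neg_apply, NNReal.coe_one]
    rw [show -(x - 0) ^ 2 / (2 * 1) = -(1 / 2) * x ^ 2 by ring]
    ring
  have key := integral_mul_deriv_eq_deriv_mul_of_integrable (u := f) (u' := f')
    (fun x _ => hd x) (fun x _ => hpdf x)
    (hint'.bdd_mul hf.aestronglyMeasurable (.of_forall hC))
    (hint.bdd_mul hf'.aestronglyMeasurable (.of_forall hC'))
    (hint.bdd_mul hf.aestronglyMeasurable (.of_forall hC))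
  rw [integral_gaussianReal_eq_integral_smul one_ne_zero,
    integral_gaussianReal_eq_integral_smul one_ne_zero]
  simp only [smul_eq_mul]
  simp only [mul_neg, integral_neg, neg_inj] at key
  calc
    _ = ∫ x, f x * (x * gaussianPDFReal 0 1 x) := integral_congr_ae (.of_forall fun x => by ring)
    _ = ∫ x, f' x * gaussianPDFReal 0 1 x := key
    _ = _ := integral_congr_ae (.of_forall fun x => by ring)

section Product

variable {ι : Type*} [Fintype ι]

/-- Resampling one coordinate of a product measure leaves the measure unchanged. -/
lemma measurePreserving_update_pi [DecidableEq ι] {X : ι → Type*} [∀ i, MeasurableSpace (X i)]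
    (μ : ∀ i, Measure (X i)) [∀ i, IsProbabilityMeasure (μ i)] (i : ι) :
    MeasurePreserving (fun p : (∀ j, X j) × X i => Function.update p.1 i p.2)
      ((Measure.pi μ).prod (μ i)) (Measure.pi μ) := by
  have hm : Measurable (fun p : (∀ j, X j) × X i => Function.update p.1 i p.2) := by
    refine measurable_pi_lambda _ fun j => ?_
    by_cases h : j = i
    · subst h
      simpa using measurable_snd
    · simp only [Function.update_of_ne h]
      fun_prop
  refine ⟨hm, (Measure.pi_eq fun s hs => ?_).symm⟩
  have hpre : (fun p : (∀ j, X j) × X i => Function.update p.1 i p.2) ⁻¹' Set.univ.pi s =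
      (Set.univ.pi (Function.update s i Set.univ)) ×ˢ s i := by
    ext p
    simp only [Set.mem_preimage, Set.mem_pi, Set.mem_univ, true_imp_iff, Set.mem_prod]
    constructor
    · intro h
      refine ⟨fun j => ?_, by simpa using h i⟩
      by_cases hj : j = i
      · subst hj
        simp
      · simpa [hj] using h j
    · rintro ⟨h, hi⟩ j
      by_cases hj : j = i
      · subst hj
        simpa using hi
      · simpa [hj] using h j
  rw [Measure.map_apply hm (.univ_pi hs), hpre, Measure.prod_prod, Measure.pi_pi,
    ← Finset.mul_prod_erase _ _ (Finset.mem_univ i),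
    ← Finset.mul_prod_erase _ (fun j => μ j (s j)) (Finset.mem_univ i), mul_comm]
  simp only [Function.update_self, measure_univ, one_mul]
  congr 1
  refine Finset.prod_congr rfl fun j hj => ?_
  rw [Function.update_of_ne (Finset.ne_of_mem_erase hj)]

lemma integrable_eval_pi_gaussianReal (i : ι) :
    Integrable (fun J : ι → ℝ => J i) (Measure.pi fun _ => gaussianReal 0 1) :=
  (measurePreserving_eval (fun _ : ι => gaussianReal 0 1) i).integrable_comp_of_integrable
    (g := id) IsGaussian.integrable_id

/-- Gaussian integration by parts in one coordinate of a standard Gaussian vector. -/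
lemma integral_eval_mul_pi_gaussianReal [DecidableEq ι] {f f' : (ι → ℝ) → ℝ} {C C' : ℝ} (i : ι)
    (hf : Continuous f) (hf' : Continuous f') (hC : ∀ J, |f J| ≤ C) (hC' : ∀ J, |f' J| ≤ C')
    (hd : ∀ J, HasDerivAt (fun x => f (Function.update J i x)) (f' J) (J i)) :
    ∫ J, J i * f J ∂(Measure.pi fun _ => gaussianReal 0 1) =
      ∫ J, f' J ∂(Measure.pi fun _ => gaussianReal 0 1) := by
  have hmp := measurePreserving_update_pi (fun _ : ι => gaussianReal 0 1) i
  have hint1 : Integrable (fun J : ι → ℝ => J i * f J)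
      (Measure.pi fun _ => gaussianReal 0 1) :=
    (integrable_eval_pi_gaussianReal i).mul_bdd hf.aestronglyMeasurable (.of_forall hC)
  have hint2 : Integrable f' (Measure.pi fun _ : ι => gaussianReal 0 1) :=
    .of_bound hf'.aestronglyMeasurable C' (.of_forall hC')
  have resample (g : (ι → ℝ) → ℝ) (hg : Integrable g (Measure.pi fun _ => gaussianReal 0 1)) :
      ∫ J, g J ∂(Measure.pi fun _ => gaussianReal 0 1) =
        ∫ J, ∫ x, g (Function.update J i x) ∂gaussianReal 0 1
          ∂(Measure.pi fun _ => gaussianReal 0 1) := by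
    conv_lhs => rw [← hmp.map_eq]
    rw [integral_map hmp.aemeasurable (by rw [hmp.map_eq]; exact hg.aestronglyMeasurable)]
    exact integral_prod _ (hmp.integrable_comp_of_integrable hg)
  rw [resample _ hint1, resample _ hint2]
  refine integral_congr_ae (.of_forall fun J => ?_)
  have hu : Continuous fun x : ℝ => Function.update J i x :=
    continuous_const.update i continuous_id
  simp only [Function.update_self]
  refine integral_id_mul_gaussianReal (hf'.comp hu) (fun x => hC _) (fun x => hC' _) fun x => ?_
  simpa using hd (Function.update J i x)

end Product

section Gibbs

variable {T : Type*} [Fintype T]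

/-- The average of `g` under the probability weights proportional to `exp ∘ h`. -/
def gibbsAvg (h g : T → ℝ) : ℝ := (∑ τ, g τ * Real.exp (h τ)) / ∑ τ, Real.exp (h τ)

lemma sum_exp_pos [Nonempty T] (h : T → ℝ) : 0 < ∑ τ, Real.exp (h τ) :=
  Finset.sum_pos (fun _ _ => Real.exp_pos _) Finset.univ_nonempty

lemma abs_gibbsAvg_le [Nonempty T] {g : T → ℝ} {C : ℝ} (h : T → ℝ) (hg : ∀ τ, |g τ| ≤ C) :
    |gibbsAvg h g| ≤ C := by
  rw [gibbsAvg, abs_div, abs_of_pos (sum_exp_pos h), div_le_iff₀ (sum_exp_pos h), Finset.mul_sum]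
  refine (Finset.abs_sum_le_sum_abs _ _).trans (Finset.sum_le_sum fun τ _ => ?_)
  rw [abs_mul, Real.abs_exp]
  exact mul_le_mul_of_nonneg_right (hg τ) (Real.exp_pos _).le

lemma gibbsAvg_sum_mul {ι : Type*} (s : Finset ι) (h : T → ℝ) (x : ι → ℝ) (g : ι → T → ℝ) :
    gibbsAvg h (fun τ => ∑ i ∈ s, x i * g i τ) = ∑ i ∈ s, x i * gibbsAvg h (g i) := by
  simp only [gibbsAvg, Finset.sum_mul, Finset.mul_sum, mul_div_assoc']
  rw [Finset.sum_comm, Finset.sum_div]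
  simp only [mul_assoc]

lemma gibbsAvg_const_mul (h : T → ℝ) (c : ℝ) (g : T → ℝ) :
    gibbsAvg h (fun τ => c * g τ) = c * gibbsAvg h g := by
  simp only [gibbsAvg, mul_assoc, ← Finset.mul_sum, mul_div_assoc]

lemma gibbsAvg_one [Nonempty T] (h : T → ℝ) : gibbsAvg h (fun _ => 1) = 1 := by
  simp only [gibbsAvg, one_mul]
  exact div_self (sum_exp_pos h).ne'

lemma hasDerivAt_log_sum_exp [Nonempty T] {h : ℝ → T → ℝ} {h' : T → ℝ} {t : ℝ}
    (hh : ∀ τ, HasDerivAt (fun s => h s τ) (h' τ) t) :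
    HasDerivAt (fun s => Real.log (∑ τ, Real.exp (h s τ))) (gibbsAvg (h t) h') t := by
  refine ((HasDerivAt.fun_sum (u := Finset.univ) fun τ _ => (hh τ).exp).log
    (sum_exp_pos (h t)).ne').congr_deriv ?_
  simp only [gibbsAvg, mul_comm]

lemma hasDerivAt_gibbsAvg [Nonempty T] {h : ℝ → T → ℝ} {h' : T → ℝ} {t : ℝ} (g : T → ℝ)
    (hh : ∀ τ, HasDerivAt (fun s => h s τ) (h' τ) t) :
    HasDerivAt (fun s => gibbsAvg (h s) g)
      (gibbsAvg (h t) (fun τ => g τ * h' τ) - gibbsAvg (h t) g * gibbsAvg (h t) h') t := by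
  have hZ := sum_exp_pos (h t)
  refine ((HasDerivAt.fun_sum (u := Finset.univ) fun τ _ => (hh τ).exp.const_mul (g τ)).div
    (HasDerivAt.fun_sum (u := Finset.univ) fun τ _ => (hh τ).exp) hZ.ne').congr_deriv ?_
  have e1 : ∑ τ, g τ * (Real.exp (h t τ) * h' τ) = ∑ τ, g τ * h' τ * Real.exp (h t τ) :=
    Finset.sum_congr rfl fun _ _ => by ring
  have e2 : ∑ τ, Real.exp (h t τ) * h' τ = ∑ τ, h' τ * Real.exp (h t τ) :=
    Finset.sum_congr rfl fun _ _ => by ring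
  rw [e1, e2]
  simp only [gibbsAvg]
  field_simp

lemma abs_log_sum_exp_le [Nonempty T] {h : T → ℝ} {S : ℝ} (hS : ∀ τ, |h τ| ≤ S) :
    |Real.log (∑ τ, Real.exp (h τ))| ≤ Real.log (Fintype.card T) + S := by
  have hcard : (1 : ℝ) ≤ Fintype.card T := by exact_mod_cast Fintype.card_pos
  rw [abs_le]
  constructor
  · obtain ⟨τ⟩ := ‹Nonempty T›
    have h1 : Real.exp (h τ) ≤ ∑ τ, Real.exp (h τ) :=
      Finset.single_le_sum (fun τ _ => (Real.exp_pos (h τ)).le) (Finset.mem_univ τ)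
    have h2 := Real.log_le_log (Real.exp_pos _) h1
    rw [Real.log_exp] at h2
    linarith [(abs_le.1 (hS τ)).1, Real.log_nonneg hcard]
  · have h1 : ∑ τ, Real.exp (h τ) ≤ Fintype.card T * Real.exp S := by
      simpa using Finset.sum_le_card_nsmul Finset.univ _ (Real.exp S)
        fun τ _ => Real.exp_le_exp.2 ((le_abs_self _).trans (hS τ))
    have h2 := Real.log_le_log (sum_exp_pos h) h1
    rwa [Real.log_mul (by positivity) (Real.exp_pos S).ne', Real.log_exp] at h2

lemma continuous_gibbsAvg [Nonempty T] {Y : Type*} [TopologicalSpace Y] {h : Y → T → ℝ}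
    (hh : ∀ τ, Continuous fun y => h y τ) (g : T → ℝ) : Continuous fun y => gibbsAvg (h y) g := by
  unfold gibbsAvg
  exact (continuous_finsetSum _ fun τ _ => (hh τ).rexp.const_mul _).div
    (continuous_finsetSum _ fun τ _ => (hh τ).rexp) fun y => (sum_exp_pos (h y)).ne'

variable {ι : Type*} [Fintype ι]

/-- For the energy `∑ i, J i * a i τ` with signs `a i τ` and standard Gaussian couplings `J`,
Gaussian integration by parts gives the Gibbs average of one interaction term. -/
lemma integral_eval_mul_gibbsAvg [Nonempty T] {a : ι → T → ℝ} (ha : ∀ i τ, |a i τ| = 1) (c : ℝ)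
    (i : ι) :
    ∫ J, J i * gibbsAvg (fun τ => c * ∑ j, J j * a j τ) (a i)
        ∂(Measure.pi fun _ => gaussianReal 0 1) =
      ∫ J, c * (1 - gibbsAvg (fun τ => c * ∑ j, J j * a j τ) (a i) ^ 2)
        ∂(Measure.pi fun _ => gaussianReal 0 1) := by
  classical
  have hH (τ : T) : Continuous fun J : ι → ℝ => c * ∑ j, J j * a j τ := by fun_prop
  have hcont := continuous_gibbsAvg hH (a i)
  have hb (J : ι → ℝ) : |gibbsAvg (fun τ => c * ∑ j, J j * a j τ) (a i)| ≤ 1 :=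
    abs_gibbsAvg_le _ fun τ => (ha i τ).le
  refine integral_eval_mul_pi_gaussianReal (C := 1) (C' := |c|) i hcont (by fun_prop) hb
    (fun J => ?_) fun J => ?_
  · rw [abs_mul]
    refine mul_le_of_le_one_right (abs_nonneg c) ?_
    have := (sq_le_one_iff_abs_le_one _).2 (hb J)
    rw [abs_le]
    constructor <;> nlinarith [sq_nonneg (gibbsAvg (fun τ => c * ∑ j, J j * a j τ) (a i))]
  · have hlin (τ : T) : HasDerivAt (fun x => c * ∑ j, Function.update J i x j * a j τ)
        (c * a i τ) (J i) := by
      have hupd := hasDerivAt_pi.1 (hasDerivAt_update J i (J i))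
      have := (HasDerivAt.fun_sum (u := Finset.univ) fun j _ =>
        (hupd j).mul_const (a j τ)).const_mul c
      refine this.congr_deriv ?_
      simp [Pi.single_apply]
    have := hasDerivAt_gibbsAvg (a i) hlin
    simp only [Function.update_eq_self] at this
    refine this.congr_deriv ?_
    have e (τ : T) : a i τ * (c * a i τ) = c * 1 := by
      rw [mul_left_comm, ← sq, ← sq_abs, ha, one_pow]
    simp only [e]
    rw [gibbsAvg_const_mul, gibbsAvg_const_mul, gibbsAvg_one]
    ring

/-- Derivative in the inverse temperature of the expected log-partition function. -/
lemma hasDerivAt_integral_log_sum_exp [Nonempty T] {a : ι → T → ℝ} (ha : ∀ i τ, |a i τ| = 1)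
    (c : ℝ) :
    HasDerivAt (fun b => ∫ J, Real.log (∑ τ, Real.exp (b * ∑ i, J i * a i τ))
        ∂(Measure.pi fun _ : ι => gaussianReal 0 1))
      (c * (Fintype.card ι - ∫ J, ∑ i, gibbsAvg (fun τ => c * ∑ j, J j * a j τ) (a i) ^ 2
        ∂(Measure.pi fun _ : ι => gaussianReal 0 1))) c := by
  have hE (J : ι → ℝ) (τ : T) : |∑ i, J i * a i τ| ≤ ∑ i, |J i| :=
    (Finset.abs_sum_le_sum_abs _ _).trans_eq (by simp only [abs_mul, ha, mul_one])
  have hint : Integrable (fun J : ι → ℝ => ∑ i, |J i|)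
      (Measure.pi fun _ : ι => gaussianReal 0 1) :=
    integrable_finsetSum _ fun i _ => (integrable_eval_pi_gaussianReal i).abs
  have hlog (b : ℝ) :
      Continuous fun J : ι → ℝ => Real.log (∑ τ, Real.exp (b * ∑ i, J i * a i τ)) :=
    Continuous.log (by fun_prop) fun J => (sum_exp_pos _).ne'
  have hH (τ : T) : Continuous fun J : ι → ℝ => c * ∑ j, J j * a j τ := by fun_prop
  have hg (i : ι) : Continuous fun J : ι → ℝ => gibbsAvg (fun τ => c * ∑ j, J j * a j τ) (a i) :=
    continuous_gibbsAvg hH (a i)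
  have hb (i : ι) (J : ι → ℝ) : |gibbsAvg (fun τ => c * ∑ j, J j * a j τ) (a i)| ≤ 1 :=
    abs_gibbsAvg_le _ fun τ => (ha i τ).le
  have hsq (i : ι) : Integrable
      (fun J : ι → ℝ => gibbsAvg (fun τ => c * ∑ j, J j * a j τ) (a i) ^ 2)
      (Measure.pi fun _ : ι => gaussianReal 0 1) := by
    refine .of_bound ((hg i).pow 2).aestronglyMeasurable 1 (.of_forall fun J => ?_)
    rw [Real.norm_eq_abs, abs_pow]
    exact pow_le_one₀ (abs_nonneg _) (hb i J)
  have key := (hasDerivAt_integral_of_dominated_loc_of_deriv_le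
    (μ := Measure.pi fun _ : ι => gaussianReal 0 1) (x₀ := c) (s := Set.univ)
    (F := fun b J => Real.log (∑ τ, Real.exp (b * ∑ i, J i * a i τ)))
    (F' := fun b J => gibbsAvg (fun τ => b * ∑ i, J i * a i τ) (fun τ => ∑ i, J i * a i τ))
    (bound := fun J => ∑ i, |J i|) Filter.univ_mem
    (.of_forall fun b => (hlog b).aestronglyMeasurable)
    (((integrable_const (Real.log (Fintype.card T))).add (hint.const_mul |c|)).mono'
      (hlog c).aestronglyMeasurable (.of_forall fun J => abs_log_sum_exp_le fun τ => by
        rw [abs_mul]; exact mul_le_mul_of_nonneg_left (hE J τ) (abs_nonneg c)))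
    (by
      simp only [gibbsAvg_sum_mul]
      exact Continuous.aestronglyMeasurable
        (continuous_finsetSum _ fun i _ => (continuous_apply i).mul (hg i)))
    (.of_forall fun J b _ => abs_gibbsAvg_le _ (hE J)) hint
    (.of_forall fun J b _ => hasDerivAt_log_sum_exp fun τ => by
      simpa using (hasDerivAt_id' b).mul_const (∑ i, J i * a i τ))).2
  refine key.congr_deriv ?_
  simp only [gibbsAvg_sum_mul]
  rw [integral_finsetSum _ fun i _ => (integrable_eval_pi_gaussianReal i).mul_bdd
      (hg i).aestronglyMeasurable (.of_forall (hb i)),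
    integral_finsetSum _ fun i _ => hsq i]
  simp only [integral_eval_mul_gibbsAvg ha, integral_const_mul]
  rw [← Finset.mul_sum]
  congr 1
  simp only [integral_sub (integrable_const _) (hsq _)]
  simp

end Gibbs

lemma abs_spinval (b : Bool) : |spinval b| = 1 := by cases b <;> simp [spinval]

lemma boltzW_eq (M : ℕ) (β : ℝ) (J : Fin M × Fin M → ℝ) (τ : Fin M → Bool) :
    boltzW M β J τ =
      Real.exp (β / Real.sqrt M * ∑ p, J p * (spinval (τ p.1) * spinval (τ p.2))) := by
  simp only [boltzW, Fintype.sum_prod_type, mul_assoc]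

/-- The squared overlap is the average over pairs `(k, l)` of the replica product of
`τ k * τ l`. -/
lemma qtilde_sq (M : ℕ) (τ₁ τ₂ : Fin M → Bool) :
    qtilde M τ₁ τ₂ ^ 2 = 1 / (M : ℝ) ^ 2 * ∑ p : Fin M × Fin M,
      spinval (τ₁ p.1) * spinval (τ₁ p.2) * (spinval (τ₂ p.1) * spinval (τ₂ p.2)) := by
  rw [qtilde, mul_pow, sq (∑ k, _), Finset.sum_mul_sum, Fintype.sum_prod_type, one_div_pow]
  congr 1
  exact Finset.sum_congr rfl fun _ _ => Finset.sum_congr rfl fun _ _ => by ring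

lemma gibbs_qtilde_sq (M : ℕ) (β : ℝ) (J : Fin M × Fin M → ℝ) :
    (∑ τ₁ : Fin M → Bool, ∑ τ₂ : Fin M → Bool,
      boltzW M β J τ₁ * boltzW M β J τ₂ * (qtilde M τ₁ τ₂) ^ 2) / (ZSK M β J) ^ 2 =
    1 / (M : ℝ) ^ 2 * ∑ p : Fin M × Fin M, gibbsAvg
      (fun τ : Fin M → Bool => β / Real.sqrt M * ∑ q, J q * (spinval (τ q.1) * spinval (τ q.2)))
      (fun τ => spinval (τ p.1) * spinval (τ p.2)) ^ 2 := by
  simp only [gibbsAvg, ← boltzW_eq, div_pow, qtilde_sq, ZSK]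
  rw [← Finset.sum_div, mul_div_assoc']
  congr 1
  simp only [sq (∑ τ : Fin M → Bool, _ * boltzW M β J τ), Finset.sum_mul_sum]
  simp only [Finset.mul_sum]
  conv_rhs => rw [Finset.sum_comm]
  refine Finset.sum_congr rfl fun τ₁ _ => ?_
  conv_rhs => rw [Finset.sum_comm]
  exact Finset.sum_congr rfl fun _ _ => Finset.sum_congr rfl fun _ _ => by ring

/-- For every `M ≥ 1`, the quenched pressure is differentiable on `ℝ` with
`α_M'(β) = β (1 − ⟨q̃₁₂²⟩_β)`. -/
theorem quenchedPressure_hasDerivAt (M : ℕ) (hM : 1 ≤ M) (β : ℝ) :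
    HasDerivAt (quenchedPressure M) (β * (1 - avgQsq M β)) β := by
  have hM0 : (0 : ℝ) < M := by exact_mod_cast hM
  have hs : Real.sqrt M ≠ 0 := (Real.sqrt_pos.2 hM0).ne'
  have hss : Real.sqrt M ^ 2 = M := Real.sq_sqrt hM0.le
  have hgen := hasDerivAt_integral_log_sum_exp
    (a := fun (p : Fin M × Fin M) (τ : Fin M → Bool) => spinval (τ p.1) * spinval (τ p.2))
    (fun p τ => by rw [abs_mul, abs_spinval, abs_spinval, one_mul]) (β / Real.sqrt M)
  have hcomp := (hgen.comp β ((hasDerivAt_id' β).div_const (Real.sqrt M))).const_mul (1 / (M : ℝ))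
  have hQ : avgQsq M β = 1 / (M : ℝ) ^ 2 * ∫ J, ∑ p : Fin M × Fin M, gibbsAvg
      (fun τ : Fin M → Bool => β / Real.sqrt M * ∑ q, J q * (spinval (τ q.1) * spinval (τ q.2)))
      (fun τ => spinval (τ p.1) * spinval (τ p.2)) ^ 2
      ∂(Measure.pi fun _ : Fin M × Fin M => gaussianReal 0 1) := by
    simp only [avgQsq, gibbs_qtilde_sq, integral_const_mul, couplingLaw]
  have hP : quenchedPressure M = fun b => 1 / (M : ℝ) *
      ∫ J, Real.log (∑ τ : Fin M → Bool, Real.exp (b / Real.sqrt M *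
        ∑ p, J p * (spinval (τ p.1) * spinval (τ p.2))))
        ∂(Measure.pi fun _ : Fin M × Fin M => gaussianReal 0 1) := by
    funext b
    simp only [quenchedPressure, ZSK, boltzW_eq, couplingLaw]
  rw [hP]
  refine hcomp.congr_deriv ?_
  rw [hQ]
  generalize ∫ J, ∑ p : Fin M × Fin M, gibbsAvg
    (fun τ : Fin M → Bool => β / Real.sqrt M * ∑ q, J q * (spinval (τ q.1) * spinval (τ q.2)))
    (fun τ => spinval (τ p.1) * spinval (τ p.2)) ^ 2
    ∂(Measure.pi fun _ : Fin M × Fin M => gaussianReal 0 1) = I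
  simp only [Fintype.card_prod, Fintype.card_fin, Nat.cast_mul]
  field_simp
  rw [hss]
  ring
end
end

section
/- Let Ĵ = (Ĵ_{kl})_{1≤k,l≤M} be a further family of i.i.d. standard Gaussian random variables, independent of J, and set Ĥ(τ) = −(1/M) Σ_{k,l=1}^M Ĵ_{kl} τ_k τ_l. Then for every integer N ≥ 1 and all β, β' ∈ ℝ, (1/N) E[ln ω_β(exp(−β'√(N/2) Ĥ))] = (M/N)(α_M(β*) − α_M(β)), where β* = √(β² + β'²N/(2M)) and ω_β acts on the function τ ↦ exp(−β'√(N/2) Ĥ(τ)). -/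
open MeasureTheory ProbabilityTheory

noncomputable section

/-- The internal-energy field `Ĥ(τ) = −(1/M) Σ_{k,l} Ĵ_{kl} τ_k τ_l`. -/
def Hhat (M : ℕ) (Jh : (Fin M × Fin M) → ℝ) (τ : Fin M → Bool) : ℝ :=
  -(1 / (M : ℝ)) * ∑ k : Fin M, ∑ l : Fin M, Jh (k, l) * spinval (τ k) * spinval (τ l)

/-- Joint law of the two independent i.i.d. standard Gaussian families `(J, Ĵ)`. -/
def jointLaw (M : ℕ) : Measure (((Fin M × Fin M) → ℝ) × ((Fin M × Fin M) → ℝ)) :=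
  (couplingLaw M).prod (couplingLaw M)

/-- Logarithm of the partition function with couplings `G` absorbing the inverse temperature. -/
def logPartition (M : ℕ) (G : (Fin M × Fin M) → ℝ) : ℝ :=
  Real.log (∑ τ : Fin M → Bool,
    Real.exp (∑ k : Fin M, ∑ l : Fin M, G (k, l) * spinval (τ k) * spinval (τ l)))

lemma abs_energy_le (M : ℕ) (G : (Fin M × Fin M) → ℝ) (τ : Fin M → Bool) :
    |∑ k : Fin M, ∑ l : Fin M, G (k, l) * spinval (τ k) * spinval (τ l)| ≤ ∑ p, |G p| := by
  rw [Fintype.sum_prod_type]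
  refine (Finset.abs_sum_le_sum_abs _ _).trans (Finset.sum_le_sum fun k _ => ?_)
  refine (Finset.abs_sum_le_sum_abs _ _).trans (Finset.sum_le_sum fun l _ => ?_)
  simp [abs_mul, abs_spinval]

lemma abs_logPartition_le (M : ℕ) (G : (Fin M × Fin M) → ℝ) :
    |logPartition M G| ≤ Real.log (Fintype.card (Fin M → Bool)) + ∑ p, |G p| := by
  set S := ∑ p, |G p|
  have hcard : (1 : ℝ) ≤ Fintype.card (Fin M → Bool) := by
    exact_mod_cast Fintype.card_pos
  have hlog := Real.log_nonneg hcard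
  have hb := fun τ => abs_le.1 (abs_energy_le M G τ)
  have hlow : Real.exp (-S) ≤ ∑ τ : Fin M → Bool,
      Real.exp (∑ k : Fin M, ∑ l : Fin M, G (k, l) * spinval (τ k) * spinval (τ l)) :=
    (Real.exp_le_exp.2 (hb fun _ => true).1).trans
      (Finset.single_le_sum (f := fun τ : Fin M → Bool =>
        Real.exp (∑ k : Fin M, ∑ l : Fin M, G (k, l) * spinval (τ k) * spinval (τ l)))
        (fun τ _ => (Real.exp_pos _).le) (Finset.mem_univ _))
  have hup : ∑ τ : Fin M → Bool,
      Real.exp (∑ k : Fin M, ∑ l : Fin M, G (k, l) * spinval (τ k) * spinval (τ l)) ≤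
      Fintype.card (Fin M → Bool) * Real.exp S := by
    refine (Finset.sum_le_card_nsmul _ _ (Real.exp S) fun τ _ =>
      Real.exp_le_exp.2 (hb τ).2).trans_eq ?_
    rw [nsmul_eq_mul, Finset.card_univ]
  have hpos := (Real.exp_pos (-S)).trans_le hlow
  have h1 := Real.log_le_log (Real.exp_pos _) hlow
  have h2 := Real.log_le_log hpos hup
  rw [Real.log_exp] at h1
  rw [Real.log_mul (by positivity) (Real.exp_pos _).ne', Real.log_exp] at h2
  rw [abs_le, logPartition]
  constructor <;> linarith

lemma measurable_logPartition (M : ℕ) : Measurable (logPartition M) := by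
  unfold logPartition
  fun_prop

instance (M : ℕ) : IsProbabilityMeasure (couplingLaw M) := by
  unfold couplingLaw
  infer_instance

lemma integrable_logPartition_smul (M : ℕ) (c : ℝ) :
    Integrable (fun J => logPartition M (c • J)) (couplingLaw M) := by
  have hcoord : ∀ p, Integrable (fun J : (Fin M × Fin M) → ℝ => |(c • J) p|) (couplingLaw M) := by
    intro p
    have h : Integrable (fun x : ℝ => x) (gaussianReal 0 1) :=
      (memLp_id_gaussianReal 1).integrable le_rfl
    have h' := (measurePreserving_eval (fun _ : Fin M × Fin M => gaussianReal 0 1)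
      p).integrable_comp_of_integrable h
    exact (h'.const_mul c).abs
  refine Integrable.mono' ((integrable_const (Real.log (Fintype.card (Fin M → Bool)))).add
    (integrable_finsetSum Finset.univ fun p _ => hcoord p))
    ((measurable_logPartition M).comp (measurable_const_smul c)).aestronglyMeasurable
    (.of_forall fun J => ?_)
  simpa using abs_logPartition_le M (c • J)

lemma gaussianReal_map_linearComb (a b : ℝ) :
    ((gaussianReal 0 1).prod (gaussianReal 0 1)).map (fun x : ℝ × ℝ => a * x.1 + b * x.2) =
      (gaussianReal 0 1).map (fun x => √(a ^ 2 + b ^ 2) * x) := by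
  have h : (fun x : ℝ × ℝ => a * x.1 + b * x.2) =
      (fun x : ℝ × ℝ => x.1 + x.2) ∘ Prod.map (fun x => a * x) (fun x => b * x) := rfl
  rw [h, ← Measure.map_map (by fun_prop) (by fun_prop),
    ← Measure.map_prod_map _ _ (by fun_prop) (by fun_prop), gaussianReal_map_const_mul,
    gaussianReal_map_const_mul, gaussianReal_map_const_mul]
  change Measure.conv (gaussianReal _ _) (gaussianReal _ _) = _
  rw [gaussianReal_conv_gaussianReal]
  congr 1
  · simp
  · ext
    simp [Real.sq_sqrt (add_nonneg (sq_nonneg a) (sq_nonneg b))]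

lemma jointLaw_map_linearComb (M : ℕ) (a b : ℝ) :
    (jointLaw M).map (fun J => a • J.1 + b • J.2) =
      (couplingLaw M).map (fun J => √(a ^ 2 + b ^ 2) • J) := by
  have e := measurePreserving_arrowProdEquivProdArrow ℝ ℝ (Fin M × Fin M)
    (fun _ => gaussianReal 0 1) (fun _ => gaussianReal 0 1)
  rw [jointLaw, couplingLaw, ← e.map_eq, Measure.map_map (by fun_prop) e.measurable]
  have hl := Measure.pi_map_pi
    (μ := fun _ : Fin M × Fin M => (gaussianReal 0 1).prod (gaussianReal 0 1))
    (f := fun _ x => a * x.1 + b * x.2) (fun _ => by fun_prop)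
  have hr := Measure.pi_map_pi (μ := fun _ : Fin M × Fin M => gaussianReal 0 1)
    (f := fun _ x => √(a ^ 2 + b ^ 2) * x) (fun _ => by fun_prop)
  simp only [gaussianReal_map_linearComb] at hl
  exact hl.trans hr.symm

lemma log_ZSK (M : ℕ) (β : ℝ) (J : (Fin M × Fin M) → ℝ) :
    Real.log (ZSK M β J) = logPartition M ((β / √M) • J) := by
  simp [ZSK, boltzW, logPartition, Finset.mul_sum, mul_assoc]

lemma log_sum_boltzW_mul_exp (M : ℕ) (β t : ℝ) (J Jh : (Fin M × Fin M) → ℝ) :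
    Real.log (∑ τ : Fin M → Bool, boltzW M β J τ * Real.exp (-t * Hhat M Jh τ)) =
      logPartition M ((β / √M) • J + (t / M) • Jh) := by
  simp only [boltzW, logPartition, Hhat, ← Real.exp_add]
  congr! 3 with τ
  simp only [Pi.add_apply, Pi.smul_apply, smul_eq_mul, Finset.mul_sum, ← Finset.sum_add_distrib]
  congr! 2
  ring

/-- `(1/N) E[ln ω_β(exp(−β'√(N/2) Ĥ))] = (M/N)(α_M(β*) − α_M(β))`
with `β* = √(β² + β'²N/(2M))`. -/
theorem internal_energy_term (M N : ℕ) (hM : 1 ≤ M) (hN : 1 ≤ N) (β β' : ℝ) :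
    (1 / (N : ℝ)) * ∫ J, Real.log
        ((∑ τ : Fin M → Bool, boltzW M β J.1 τ *
            Real.exp (-(β' * Real.sqrt ((N : ℝ) / 2)) * Hhat M J.2 τ)) / ZSK M β J.1)
      ∂(jointLaw M)
    = ((M : ℝ) / (N : ℝ)) *
        (quenchedPressure M (Real.sqrt (β ^ 2 + β' ^ 2 * (N : ℝ) / (2 * (M : ℝ))))
          - quenchedPressure M β) := by
  have hM0 : (0 : ℝ) < M := by exact_mod_cast hM
  set t := β' * √((N : ℝ) / 2)
  set a := β / √M
  set b := t / M
  have hc : √(β ^ 2 + β' ^ 2 * (N : ℝ) / (2 * (M : ℝ))) / √M = √(a ^ 2 + b ^ 2) := by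
    rw [← Real.sqrt_div (by positivity)]
    congr 1
    simp only [a, b, t, div_pow, mul_pow, Real.sq_sqrt hM0.le,
      Real.sq_sqrt (show (0 : ℝ) ≤ N / 2 by positivity)]
    field_simp
  have hmap := jointLaw_map_linearComb M a b
  have hlin : Measurable fun J : ((Fin M × Fin M) → ℝ) × ((Fin M × Fin M) → ℝ) =>
      a • J.1 + b • J.2 := by fun_prop
  have hdil : Measurable fun J : (Fin M × Fin M) → ℝ => √(a ^ 2 + b ^ 2) • J := by fun_prop
  have hmeas := measurable_logPartition M
  have hint_num : Integrable (fun J => logPartition M (a • J.1 + b • J.2)) (jointLaw M) := by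
    refine (integrable_map_measure hmeas.aestronglyMeasurable hlin.aemeasurable).1 ?_
    rw [hmap]
    exact (integrable_map_measure hmeas.aestronglyMeasurable hdil.aemeasurable).2
      (integrable_logPartition_smul M _)
  have hint_den : Integrable (fun J => logPartition M (a • J.1)) (jointLaw M) :=
    (integrable_logPartition_smul M a).comp_fst _
  have hnum : ∫ J, logPartition M (a • J.1 + b • J.2) ∂jointLaw M =
      ∫ J, logPartition M (√(a ^ 2 + b ^ 2) • J) ∂couplingLaw M := by
    rw [← integral_map hlin.aemeasurable hmeas.aestronglyMeasurable, hmap,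
      integral_map hdil.aemeasurable hmeas.aestronglyMeasurable]
  have hden : ∫ J, logPartition M (a • J.1) ∂jointLaw M =
      ∫ J, logPartition M (a • J) ∂couplingLaw M := by
    simpa [jointLaw] using integral_fun_fst (μ := couplingLaw M) (ν := couplingLaw M)
      (fun J => logPartition M (a • J))
  have hlog : ∀ J : ((Fin M × Fin M) → ℝ) × ((Fin M × Fin M) → ℝ),
      Real.log ((∑ τ : Fin M → Bool, boltzW M β J.1 τ * Real.exp (-t * Hhat M J.2 τ)) /
        ZSK M β J.1) = logPartition M (a • J.1 + b • J.2) - logPartition M (a • J.1) := by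
    intro J
    rw [Real.log_div, log_ZSK, log_sum_boltzW_mul_exp]
    · exact (Finset.sum_pos (fun τ _ => mul_pos (Real.exp_pos _) (Real.exp_pos _))
        Finset.univ_nonempty).ne'
    · exact (Finset.sum_pos (fun τ _ => Real.exp_pos _) Finset.univ_nonempty).ne'
  simp only [hlog, quenchedPressure, log_ZSK, hc]
  rw [integral_sub hint_num hint_den, hnum, hden]
  field_simp
  rfl
end
end

section
/- In the random Gibbs/Gaussian setup, define φ(λ) = E[ln Σ_τ W_τ exp(λ H_τ)] for λ ∈ ℝ. Then φ is four times differentiable at λ = 0, φ''(0) = 1 − ⟨C_{12}⟩, and its fourth derivative at 0 is φ⁗(0) = −6(⟨C_{12}²⟩ − 4⟨C_{12}C_{13}⟩ + 3⟨C_{12}C_{34}⟩). -/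
open MeasureTheory ProbabilityTheory Filter

noncomputable section

/-- The `k`-th moment of `h` under the Gibbs measure with weights proportional to
`w a * exp (x * h a)`. -/
def gibbsMoment {S : Type*} [Fintype S] (w h : S → ℝ) (k : ℕ) (x : ℝ) : ℝ :=
  (∑ a, w a * h a ^ k * Real.exp (x * h a)) / ∑ a, w a * Real.exp (x * h a)

section Deterministic

variable {S : Type*} [Fintype S] {w h : S → ℝ}

lemma partition_pos (hw : ∀ a, 0 ≤ w a) (hw1 : ∑ a, w a = 1) (x : ℝ) :
    0 < ∑ a, w a * Real.exp (x * h a) := by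
  have hne : ∃ a ∈ Finset.univ, 0 < w a := by
    by_contra! hcon
    have : ∑ a, w a ≤ 0 := Finset.sum_nonpos hcon
    linarith
  obtain ⟨a, ha, hwa⟩ := hne
  exact Finset.sum_pos' (fun b _ => mul_nonneg (hw b) (Real.exp_pos _).le)
    ⟨a, ha, mul_pos hwa (Real.exp_pos _)⟩

lemma hasDerivAt_partition (w h : S → ℝ) (k : ℕ) (x : ℝ) :
    HasDerivAt (fun y => ∑ a, w a * h a ^ k * Real.exp (y * h a))
      (∑ a, w a * h a ^ (k + 1) * Real.exp (x * h a)) x := by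
  refine HasDerivAt.fun_sum fun a _ => ?_
  have := (((hasDerivAt_id x).mul_const (h a)).exp).const_mul (w a * h a ^ k)
  refine this.congr_deriv ?_
  simp only [id]
  ring

lemma hasDerivAt_log_partition (hw : ∀ a, 0 ≤ w a) (hw1 : ∑ a, w a = 1) (x : ℝ) :
    HasDerivAt (fun y => Real.log (∑ a, w a * Real.exp (y * h a))) (gibbsMoment w h 1 x) x := by
  have := hasDerivAt_partition w h 0 x
  simp only [pow_zero, mul_one, zero_add] at this
  exact this.log (partition_pos hw hw1 x).ne'

lemma hasDerivAt_gibbsMoment (hw : ∀ a, 0 ≤ w a) (hw1 : ∑ a, w a = 1) (k : ℕ) (x : ℝ) :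
    HasDerivAt (gibbsMoment w h k)
      (gibbsMoment w h (k + 1) x - gibbsMoment w h k x * gibbsMoment w h 1 x) x := by
  have h0 := hasDerivAt_partition w h 0 x
  simp only [pow_zero, mul_one, zero_add] at h0
  have hZ := (partition_pos (h := h) hw hw1 x).ne'
  refine ((hasDerivAt_partition w h k x).div h0 hZ).congr_deriv ?_
  simp only [gibbsMoment]
  field_simp

lemma abs_gibbsMoment_le (hw : ∀ a, 0 ≤ w a) (hw1 : ∑ a, w a = 1) (k : ℕ) (x : ℝ) :
    |gibbsMoment w h k x| ≤ (∑ a, |h a|) ^ k := by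
  have hZ := partition_pos (h := h) hw hw1 x
  rw [gibbsMoment, abs_div, abs_of_pos hZ, div_le_iff₀ hZ, Finset.mul_sum]
  refine (Finset.abs_sum_le_sum_abs _ _).trans (Finset.sum_le_sum fun a _ => ?_)
  rw [abs_mul, abs_mul, abs_of_nonneg (hw a), abs_pow, abs_of_pos (Real.exp_pos _)]
  have hB : |h a| ^ k ≤ (∑ a, |h a|) ^ k := by
    gcongr
    exact Finset.single_le_sum (f := fun a => |h a|) (fun _ _ => abs_nonneg _) (Finset.mem_univ a)
  have := mul_le_mul_of_nonneg_right hB (mul_nonneg (hw a) (Real.exp_pos (x * h a)).le)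
  linarith

lemma gibbsMoment_zero (hw1 : ∑ a, w a = 1) (k : ℕ) :
    gibbsMoment w h k 0 = ∑ a, w a * h a ^ k := by
  simp [gibbsMoment, hw1]

lemma abs_log_partition_le (hw : ∀ a, 0 ≤ w a) (hw1 : ∑ a, w a = 1) (x : ℝ) :
    |Real.log (∑ a, w a * Real.exp (x * h a))| ≤ |x| * ∑ a, |h a| := by
  have hZ := partition_pos (h := h) hw hw1 x
  have hB (a : S) : |x * h a| ≤ |x| * ∑ a, |h a| := by
    rw [abs_mul]
    gcongr
    exact Finset.single_le_sum (f := fun a => |h a|) (fun _ _ => abs_nonneg _) (Finset.mem_univ a)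
  rw [abs_le, Real.le_log_iff_exp_le hZ, Real.log_le_iff_le_exp hZ]
  constructor
  · calc _ = ∑ a, w a * Real.exp (-(|x| * ∑ a, |h a|)) := by rw [← Finset.sum_mul, hw1, one_mul]
      _ ≤ _ := Finset.sum_le_sum fun a _ => mul_le_mul_of_nonneg_left
        (Real.exp_le_exp.2 (abs_le.1 (hB a)).1) (hw a)
  · calc _ ≤ ∑ a, w a * Real.exp (|x| * ∑ a, |h a|) := Finset.sum_le_sum fun a _ =>
          mul_le_mul_of_nonneg_left (Real.exp_le_exp.2 (abs_le.1 (hB a)).2) (hw a)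
      _ = _ := by rw [← Finset.sum_mul, hw1, one_mul]

lemma abs_mul_le_pow_add {p q B : ℝ} {i j : ℕ} (k : ℕ) (hk : i + j = k) (hp : |p| ≤ B ^ i)
    (hq : |q| ≤ B ^ j) : |p * q| ≤ B ^ k := by
  rw [abs_mul, ← hk, pow_add]
  exact mul_le_mul hp hq (abs_nonneg _) ((abs_nonneg _).trans hp)

/-- The variance of `h` under the Gibbs measure with weights proportional to
`w a * exp (x * h a)`. -/
def gibbsVariance (w h : S → ℝ) (x : ℝ) : ℝ := gibbsMoment w h 2 x - gibbsMoment w h 1 x ^ 2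

/-- The third cumulant of `h` under the Gibbs measure with weights proportional to
`w a * exp (x * h a)`. -/
def gibbsThirdCumulant (w h : S → ℝ) (x : ℝ) : ℝ :=
  gibbsMoment w h 3 x - 3 * (gibbsMoment w h 2 x * gibbsMoment w h 1 x) +
    2 * gibbsMoment w h 1 x ^ 3

/-- The fourth cumulant of `h` under the Gibbs measure with weights proportional to
`w a * exp (x * h a)`. -/
def gibbsFourthCumulant (w h : S → ℝ) (x : ℝ) : ℝ :=
  gibbsMoment w h 4 x - 4 * (gibbsMoment w h 3 x * gibbsMoment w h 1 x)
    - 3 * gibbsMoment w h 2 x ^ 2 + 12 * (gibbsMoment w h 2 x * gibbsMoment w h 1 x ^ 2)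
    - 6 * gibbsMoment w h 1 x ^ 4

lemma hasDerivAt_gibbsMoment_one (hw : ∀ a, 0 ≤ w a) (hw1 : ∑ a, w a = 1) (x : ℝ) :
    HasDerivAt (gibbsMoment w h 1) (gibbsVariance w h x) x :=
  (hasDerivAt_gibbsMoment hw hw1 1 x).congr_deriv (by rw [gibbsVariance]; ring)

lemma hasDerivAt_gibbsVariance (hw : ∀ a, 0 ≤ w a) (hw1 : ∑ a, w a = 1) (x : ℝ) :
    HasDerivAt (gibbsVariance w h) (gibbsThirdCumulant w h x) x := by
  have h1 := hasDerivAt_gibbsMoment (h := h) hw hw1 1 x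
  have h2 := hasDerivAt_gibbsMoment (h := h) hw hw1 2 x
  refine (h2.fun_sub (h1.fun_pow 2)).congr_deriv ?_
  rw [gibbsThirdCumulant]
  norm_num
  ring

lemma hasDerivAt_gibbsThirdCumulant (hw : ∀ a, 0 ≤ w a) (hw1 : ∑ a, w a = 1) (x : ℝ) :
    HasDerivAt (gibbsThirdCumulant w h) (gibbsFourthCumulant w h x) x := by
  have h1 := hasDerivAt_gibbsMoment (h := h) hw hw1 1 x
  have h2 := hasDerivAt_gibbsMoment (h := h) hw hw1 2 x
  have h3 := hasDerivAt_gibbsMoment (h := h) hw hw1 3 x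
  refine ((h3.fun_sub ((h2.fun_mul h1).const_mul 3)).fun_add
    ((h1.fun_pow 3).const_mul 2)).congr_deriv ?_
  rw [gibbsFourthCumulant]
  norm_num
  ring

lemma abs_gibbsVariance_le (hw : ∀ a, 0 ≤ w a) (hw1 : ∑ a, w a = 1) (x : ℝ) :
    |gibbsVariance w h x| ≤ 2 * (∑ a, |h a|) ^ 2 := by
  have h1 := abs_gibbsMoment_le (h := h) hw hw1 1 x
  have h2 := abs_gibbsMoment_le (h := h) hw hw1 2 x
  have h11 := abs_mul_le_pow_add 2 rfl h1 h1
  rw [gibbsVariance]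
  rw [abs_le] at *
  constructor <;> linarith

lemma abs_gibbsThirdCumulant_le (hw : ∀ a, 0 ≤ w a) (hw1 : ∑ a, w a = 1) (x : ℝ) :
    |gibbsThirdCumulant w h x| ≤ 6 * (∑ a, |h a|) ^ 3 := by
  have h1 := abs_gibbsMoment_le (h := h) hw hw1 1 x
  have h2 := abs_gibbsMoment_le (h := h) hw hw1 2 x
  have h3 := abs_gibbsMoment_le (h := h) hw hw1 3 x
  have h21 := abs_mul_le_pow_add 3 rfl h2 h1
  have h111 := abs_mul_le_pow_add 3 rfl (abs_mul_le_pow_add 2 rfl h1 h1) h1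
  rw [gibbsThirdCumulant]
  rw [abs_le] at *
  constructor <;> linarith

lemma abs_gibbsFourthCumulant_le (hw : ∀ a, 0 ≤ w a) (hw1 : ∑ a, w a = 1) (x : ℝ) :
    |gibbsFourthCumulant w h x| ≤ 26 * (∑ a, |h a|) ^ 4 := by
  have h1 := abs_gibbsMoment_le (h := h) hw hw1 1 x
  have h2 := abs_gibbsMoment_le (h := h) hw hw1 2 x
  have h3 := abs_gibbsMoment_le (h := h) hw hw1 3 x
  have h4 := abs_gibbsMoment_le (h := h) hw hw1 4 x
  have h31 := abs_mul_le_pow_add 4 rfl h3 h1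
  have h22 := abs_mul_le_pow_add 4 rfl h2 h2
  have h11 := abs_mul_le_pow_add 2 rfl h1 h1
  have h211 := abs_mul_le_pow_add 4 rfl h2 h11
  have h1111 := abs_mul_le_pow_add 4 rfl h11 h11
  rw [gibbsFourthCumulant]
  rw [abs_le] at *
  constructor <;> linarith

lemma gibbsVariance_zero (hw1 : ∑ a, w a = 1) :
    gibbsVariance w h 0 = ∑ a, ∑ b, w a * w b * (h a * h a - h a * h b) := by
  have key (i j : ℕ) : ∑ a, ∑ b, w a * w b * (h a ^ i * h b ^ j) =
      gibbsMoment w h i 0 * gibbsMoment w h j 0 := by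
    simp only [gibbsMoment_zero hw1, Finset.sum_mul, Finset.mul_sum]
    rw [Finset.sum_comm]
    refine Finset.sum_congr rfl fun a _ => Finset.sum_congr rfl fun b _ => ?_
    ring
  have h0 : gibbsMoment w h 0 0 = 1 := by simp [gibbsMoment_zero hw1, hw1]
  calc gibbsVariance w h 0 = gibbsMoment w h 2 0 * gibbsMoment w h 0 0 -
        gibbsMoment w h 1 0 * gibbsMoment w h 1 0 := by rw [gibbsVariance, h0]; ring
    _ = _ := by
      simp only [← key, ← Finset.sum_sub_distrib]
      refine Finset.sum_congr rfl fun a _ => Finset.sum_congr rfl fun b _ => ?_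
      ring

lemma gibbsFourthCumulant_zero (hw1 : ∑ a, w a = 1) :
    gibbsFourthCumulant w h 0 = ∑ a, ∑ b, ∑ c, ∑ d, w a * w b * w c * w d *
      (h a * h a * h a * h a - 4 * (h b * h b * h b * h c) - 3 * (h a * h a * h b * h b) +
        12 * (h a * h a * h b * h c) - 6 * (h a * h b * h c * h d)) := by
  have key (i j k l : ℕ) :
      ∑ a, ∑ b, ∑ c, ∑ d, w a * w b * w c * w d * (h a ^ i * h b ^ j * h c ^ k * h d ^ l) =
        gibbsMoment w h i 0 * (gibbsMoment w h j 0 * (gibbsMoment w h k 0 *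
          gibbsMoment w h l 0)) := by
    simp only [gibbsMoment_zero hw1]
    simp_rw [Finset.sum_mul_sum, Finset.mul_sum]
    refine Finset.sum_congr rfl fun a _ => Finset.sum_congr rfl fun b _ =>
      Finset.sum_congr rfl fun c _ => Finset.sum_congr rfl fun d _ => ?_
    ring
  have h0 : gibbsMoment w h 0 0 = 1 := by simp [gibbsMoment_zero hw1, hw1]
  have h4 := key 4 0 0 0
  have h31 := key 0 3 1 0
  have h22 := key 2 2 0 0
  have h211 := key 2 1 1 0
  have h1111 := key 1 1 1 1
  simp only [h0, mul_one, one_mul] at h4 h31 h22 h211 h1111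
  have : gibbsFourthCumulant w h 0 = gibbsMoment w h 4 0 -
      4 * (gibbsMoment w h 3 0 * gibbsMoment w h 1 0) -
      3 * (gibbsMoment w h 2 0 * gibbsMoment w h 2 0) +
      12 * (gibbsMoment w h 2 0 * (gibbsMoment w h 1 0 * gibbsMoment w h 1 0)) -
      6 * (gibbsMoment w h 1 0 * (gibbsMoment w h 1 0 *
        (gibbsMoment w h 1 0 * gibbsMoment w h 1 0))) := by
    rw [gibbsFourthCumulant]
    ring
  rw [this, ← h4, ← h31, ← h22, ← h211, ← h1111]
  simp only [Finset.mul_sum, ← Finset.sum_sub_distrib, ← Finset.sum_add_distrib]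
  refine Finset.sum_congr rfl fun a _ => Finset.sum_congr rfl fun b _ =>
    Finset.sum_congr rfl fun c _ => Finset.sum_congr rfl fun d _ => ?_
  ring

/-- Averages over four replicas of the overlap monomials produced by Wick's formula. -/
lemma sum_wick_fourthCumulant (C : S → S → ℝ) (hw1 : ∑ a, w a = 1) :
    ∑ a, ∑ b, ∑ c, ∑ d, w a * w b * w c * w d * (-6 * C a b ^ 2 + 24 * (C a b * C a c) -
      6 * (C a b * C c d + C a c * C b d + C a d * C b c)) =
    -6 * ((∑ a, ∑ b, w a * w b * C a b ^ 2) -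
      4 * (∑ a, ∑ b, ∑ c, w a * w b * w c * (C a b * C a c)) +
      3 * (∑ a, ∑ b, ∑ c, ∑ d, w a * w b * w c * w d * (C a b * C c d))) := by
  have h3 : ∑ a, ∑ b, ∑ c, ∑ d, w a * w b * w c * w d * (C a b * C a c) =
      ∑ a, ∑ b, ∑ c, w a * w b * w c * (C a b * C a c) := by
    refine Finset.sum_congr rfl fun a _ => Finset.sum_congr rfl fun b _ =>
      Finset.sum_congr rfl fun c _ => ?_
    rw [← Finset.sum_mul, ← Finset.mul_sum, hw1, mul_one]
  have h2 : ∑ a, ∑ b, ∑ c, ∑ d, w a * w b * w c * w d * C a b ^ 2 =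
      ∑ a, ∑ b, w a * w b * C a b ^ 2 := by
    refine Finset.sum_congr rfl fun a _ => Finset.sum_congr rfl fun b _ => ?_
    simp_rw [← Finset.sum_mul, ← Finset.mul_sum, hw1, mul_one]
    rw [← Finset.mul_sum, hw1, mul_one]
  have hbc : ∑ a, ∑ b, ∑ c, ∑ d, w a * w b * w c * w d * (C a c * C b d) =
      ∑ a, ∑ b, ∑ c, ∑ d, w a * w b * w c * w d * (C a b * C c d) := by
    refine Finset.sum_congr rfl fun a _ => ?_
    rw [Finset.sum_comm]
    refine Finset.sum_congr rfl fun b _ => Finset.sum_congr rfl fun c _ =>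
      Finset.sum_congr rfl fun d _ => ?_
    ring
  have hbd : ∑ a, ∑ b, ∑ c, ∑ d, w a * w b * w c * w d * (C a d * C b c) =
      ∑ a, ∑ b, ∑ c, ∑ d, w a * w b * w c * w d * (C a c * C b d) := by
    refine Finset.sum_congr rfl fun a _ => Finset.sum_congr rfl fun b _ => ?_
    rw [Finset.sum_comm]
    refine Finset.sum_congr rfl fun c _ => Finset.sum_congr rfl fun d _ => ?_
    ring
  have hsplit : ∑ a, ∑ b, ∑ c, ∑ d, w a * w b * w c * w d *
      (-6 * C a b ^ 2 + 24 * (C a b * C a c) -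
        6 * (C a b * C c d + C a c * C b d + C a d * C b c)) =
      -6 * (∑ a, ∑ b, ∑ c, ∑ d, w a * w b * w c * w d * C a b ^ 2) +
      24 * (∑ a, ∑ b, ∑ c, ∑ d, w a * w b * w c * w d * (C a b * C a c)) -
      6 * ((∑ a, ∑ b, ∑ c, ∑ d, w a * w b * w c * w d * (C a b * C c d)) +
        (∑ a, ∑ b, ∑ c, ∑ d, w a * w b * w c * w d * (C a c * C b d)) +
        ∑ a, ∑ b, ∑ c, ∑ d, w a * w b * w c * w d * (C a d * C b c)) := by
    simp only [Finset.mul_sum, ← Finset.sum_sub_distrib, ← Finset.sum_add_distrib]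
    refine Finset.sum_congr rfl fun a _ => Finset.sum_congr rfl fun b _ =>
      Finset.sum_congr rfl fun c _ => Finset.sum_congr rfl fun d _ => ?_
    ring
  rw [hsplit, hbd, hbc, h2, h3]
  ring

end Deterministic

section Gaussian

open scoped NNReal

lemma integral_sq_gaussianReal (v : ℝ≥0) : ∫ x, x ^ 2 ∂(gaussianReal 0 v) = v := by
  have := variance_id_gaussianReal (μ := 0) (v := v)
  rw [variance_of_integral_eq_zero aemeasurable_id (by simp)] at this
  simpa using this

lemma integral_pow_four_gaussianReal (v : ℝ≥0) :
    ∫ x, x ^ 4 ∂(gaussianReal 0 v) = 3 * (v : ℝ) ^ 2 := by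
  have key := iteratedDeriv_mgf_zero (X := id) (μ := gaussianReal 0 v) (by simp) 4
  have hE (t : ℝ) : HasDerivAt (fun t : ℝ => Real.exp (v * t ^ 2 / 2))
      (v * t * Real.exp (v * t ^ 2 / 2)) t := by
    refine ((((hasDerivAt_pow 2 t).const_mul (v : ℝ)).div_const 2).exp).congr_deriv ?_
    push_cast
    ring
  have h1 : deriv (fun t : ℝ => Real.exp (v * t ^ 2 / 2)) =
      fun t => v * t * Real.exp (v * t ^ 2 / 2) := funext fun t => (hE t).deriv
  have h2 : deriv (fun t : ℝ => v * t * Real.exp (v * t ^ 2 / 2)) =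
      fun t => (v + v ^ 2 * t ^ 2) * Real.exp (v * t ^ 2 / 2) := funext fun t => by
    rw [(((hasDerivAt_id' t).const_mul (v : ℝ)).fun_mul (hE t)).deriv]
    ring
  have h3 : deriv (fun t : ℝ => (v + v ^ 2 * t ^ 2) * Real.exp (v * t ^ 2 / 2)) =
      fun t => (3 * v ^ 2 * t + v ^ 3 * t ^ 3) * Real.exp (v * t ^ 2 / 2) := funext fun t => by
    rw [((((hasDerivAt_pow 2 t).const_mul ((v : ℝ) ^ 2)).const_add (v : ℝ)).fun_mul (hE t)).deriv]
    push_cast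
    ring
  have h4 : deriv (fun t : ℝ => (3 * v ^ 2 * t + v ^ 3 * t ^ 3) * Real.exp (v * t ^ 2 / 2)) 0 =
      3 * (v : ℝ) ^ 2 := by
    rw [((((hasDerivAt_id' (0 : ℝ)).const_mul (3 * (v : ℝ) ^ 2)).fun_add
      ((hasDerivAt_pow 3 (0 : ℝ)).const_mul ((v : ℝ) ^ 3))).fun_mul (hE 0)).deriv]
    simp
  rw [mgf_id_gaussianReal] at key
  simp only [zero_mul, zero_add, iteratedDeriv_succ, iteratedDeriv_zero, h1, h2, h3, h4] at key
  simpa using key.symm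

variable {Ω S : Type*} [MeasurableSpace Ω] [Fintype S] {P : Measure Ω} {C : S → S → ℝ}
  {H : S → Ω → ℝ}

lemma integrable_pow_gaussianReal (v : ℝ≥0) (n : ℕ) :
    Integrable (fun x : ℝ => x ^ n) (gaussianReal 0 v) := by
  have := (memLp_id_gaussianReal (μ := 0) (v := v) n).integrable_norm_pow'
  refine this.mono (by fun_prop) (ae_of_all _ fun x => by simp)

lemma integrable_linearComb_pow
    (hHmeas : ∀ a, Measurable (H a))
    (hGauss : ∀ v : S → ℝ, Measure.map (fun ω => ∑ a : S, v a * H a ω) P =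
      gaussianReal 0 (Real.toNNReal (∑ a : S, ∑ b : S, v a * v b * C a b)))
    (v : S → ℝ) (n : ℕ) : Integrable (fun ω => (∑ a, v a * H a ω) ^ n) P := by
  have := integrable_pow_gaussianReal (∑ a : S, ∑ b : S, v a * v b * C a b).toNNReal n
  rw [← hGauss] at this
  exact this.comp_measurable (by fun_prop)

lemma integral_linearComb_sq
    (hpsd : ∀ v : S → ℝ, 0 ≤ ∑ a : S, ∑ b : S, v a * v b * C a b)
    (hHmeas : ∀ a, Measurable (H a))
    (hGauss : ∀ v : S → ℝ, Measure.map (fun ω => ∑ a : S, v a * H a ω) P =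
      gaussianReal 0 (Real.toNNReal (∑ a : S, ∑ b : S, v a * v b * C a b)))
    (v : S → ℝ) : ∫ ω, (∑ a, v a * H a ω) ^ 2 ∂P = ∑ a, ∑ b, v a * v b * C a b := by
  have := integral_sq_gaussianReal (∑ a : S, ∑ b : S, v a * v b * C a b).toNNReal
  rw [← hGauss, integral_map (by fun_prop) (by fun_prop), Real.coe_toNNReal _ (hpsd v)] at this
  exact this

lemma integral_linearComb_pow_four
    (hpsd : ∀ v : S → ℝ, 0 ≤ ∑ a : S, ∑ b : S, v a * v b * C a b)
    (hHmeas : ∀ a, Measurable (H a))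
    (hGauss : ∀ v : S → ℝ, Measure.map (fun ω => ∑ a : S, v a * H a ω) P =
      gaussianReal 0 (Real.toNNReal (∑ a : S, ∑ b : S, v a * v b * C a b)))
    (v : S → ℝ) :
    ∫ ω, (∑ a, v a * H a ω) ^ 4 ∂P = 3 * (∑ a, ∑ b, v a * v b * C a b) ^ 2 := by
  have := integral_pow_four_gaussianReal (∑ a : S, ∑ b : S, v a * v b * C a b).toNNReal
  rw [← hGauss, integral_map (by fun_prop) (by fun_prop), Real.coe_toNNReal _ (hpsd v)] at this
  exact this

/-- Wick's formula for products of two jointly Gaussian variables. -/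
lemma wick_two
    (hsymm : ∀ a b, C a b = C b a)
    (hpsd : ∀ v : S → ℝ, 0 ≤ ∑ a : S, ∑ b : S, v a * v b * C a b)
    (hHmeas : ∀ a, Measurable (H a))
    (hGauss : ∀ v : S → ℝ, Measure.map (fun ω => ∑ a : S, v a * H a ω) P =
      gaussianReal 0 (Real.toNNReal (∑ a : S, ∑ b : S, v a * v b * C a b)))
    (a b : S) :
    Integrable (fun ω => H a ω * H b ω) P ∧ ∫ ω, H a ω * H b ω ∂P = C a b := by
  classical
  let u (y : ℝ) (s : S) : ℝ := (if s = a then 1 else 0) + y * (if s = b then 1 else 0)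
  have hL (y : ℝ) (ω : Ω) : ∑ s, u y s * H s ω = H a ω + y * H b ω := by
    simp [u, add_mul, Finset.sum_add_distrib]
  have hQ (y : ℝ) : ∑ s, ∑ t, u y s * u y t * C s t =
      C a a + y ^ 2 * C b b + 2 * y * C a b := by
    simp [u, add_mul, mul_add, Finset.sum_add_distrib, hsymm b a]
    ring
  have hI (y : ℝ) := integrable_linearComb_pow hHmeas hGauss (u y) 2
  have hE (y : ℝ) := integral_linearComb_sq hpsd hHmeas hGauss (u y)
  simp only [hL, hQ] at hI hE
  have hpol : (fun ω => H a ω * H b ω) =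
      fun ω => (1 / 4 : ℝ) * ((H a ω + 1 * H b ω) ^ 2 - (H a ω + (-1) * H b ω) ^ 2) := by
    funext ω
    ring
  rw [hpol]
  refine ⟨((hI 1).sub (hI (-1))).const_mul _, ?_⟩
  rw [integral_const_mul, integral_sub (hI 1) (hI (-1)), hE, hE]
  ring

/-- Wick's formula for products of four jointly Gaussian variables. -/
lemma wick_four
    (hsymm : ∀ a b, C a b = C b a)
    (hpsd : ∀ v : S → ℝ, 0 ≤ ∑ a : S, ∑ b : S, v a * v b * C a b)
    (hHmeas : ∀ a, Measurable (H a))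
    (hGauss : ∀ v : S → ℝ, Measure.map (fun ω => ∑ a : S, v a * H a ω) P =
      gaussianReal 0 (Real.toNNReal (∑ a : S, ∑ b : S, v a * v b * C a b)))
    (a b c d : S) :
    Integrable (fun ω => H a ω * H b ω * H c ω * H d ω) P ∧
      ∫ ω, H a ω * H b ω * H c ω * H d ω ∂P = C a b * C c d + C a c * C b d + C a d * C b c := by
  classical
  let u (y z t : ℝ) (s : S) : ℝ := (if s = a then 1 else 0) + y * (if s = b then 1 else 0) +
    z * (if s = c then 1 else 0) + t * (if s = d then 1 else 0)
  have hL (y z t : ℝ) (ω : Ω) :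
      ∑ s, u y z t s * H s ω = H a ω + y * H b ω + z * H c ω + t * H d ω := by
    simp [u, add_mul, Finset.sum_add_distrib]
  have hQ (y z t : ℝ) : ∑ s, ∑ r, u y z t s * u y z t r * C s r =
      C a a + y ^ 2 * C b b + z ^ 2 * C c c + t ^ 2 * C d d + 2 * (y * C a b + z * C a c +
        t * C a d + y * z * C b c + y * t * C b d + z * t * C c d) := by
    simp [u, add_mul, mul_add, Finset.sum_add_distrib, hsymm b a, hsymm c a, hsymm d a,
      hsymm c b, hsymm d b, hsymm d c]
    ring
  have hI (y z t : ℝ) := integrable_linearComb_pow hHmeas hGauss (u y z t) 4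
  have hE (y z t : ℝ) := integral_linearComb_pow_four hpsd hHmeas hGauss (u y z t)
  simp only [hL, hQ] at hI hE
  let σ : Fin 2 → ℝ := ![1, -1]
  have hpol : (fun ω => H a ω * H b ω * H c ω * H d ω) =
      fun ω => ∑ i : Fin 2, ∑ j : Fin 2, ∑ k : Fin 2, σ i * σ j * σ k / 192 *
        (H a ω + σ i * H b ω + σ j * H c ω + σ k * H d ω) ^ 4 := by
    funext ω
    simp [σ, Fin.sum_univ_two]
    ring
  have hI' (i j k : Fin 2) := (hI (σ i) (σ j) (σ k)).const_mul (σ i * σ j * σ k / 192)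
  rw [hpol]
  refine ⟨integrable_finsetSum _ fun i _ => integrable_finsetSum _ fun j _ =>
    integrable_finsetSum _ fun k _ => hI' i j k, ?_⟩
  rw [integral_finsetSum _ fun i _ => integrable_finsetSum _ fun j _ =>
    integrable_finsetSum _ fun k _ => hI' i j k]
  simp_rw [integral_finsetSum _ fun j _ => integrable_finsetSum _ fun k _ => hI' _ j k,
    integral_finsetSum _ fun k _ => hI' _ _ k, integral_const_mul, hE]
  simp [σ, Fin.sum_univ_two]
  ring

lemma integrable_sum_abs_pow [IsFiniteMeasure P]
    (hHmeas : ∀ a, Measurable (H a))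
    (hGauss : ∀ v : S → ℝ, Measure.map (fun ω => ∑ a : S, v a * H a ω) P =
      gaussianReal 0 (Real.toNNReal (∑ a : S, ∑ b : S, v a * v b * C a b))) (n : ℕ) :
    Integrable (fun ω => (∑ a, |H a ω|) ^ n) P := by
  classical
  have hmem (a : S) : MemLp (fun ω => |H a ω|) n P := by
    have h1 := memLp_id_gaussianReal (μ := 0) (v := (∑ s : S, ∑ t : S,
      (Pi.single a 1 : S → ℝ) s * (Pi.single a 1 : S → ℝ) t * C s t).toNNReal) n
    rw [← hGauss] at h1
    have h2 := h1.comp_of_map (by fun_prop)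
    have h3 : (id ∘ fun ω => ∑ s, (Pi.single a 1 : S → ℝ) s * H s ω) = H a := by
      funext ω
      simp [Pi.single_apply]
    rw [h3] at h2
    exact h2.abs
  have := (memLp_finsetSum Finset.univ fun a _ => hmem a).integrable_norm_pow'
  refine this.congr (ae_of_all _ fun ω => ?_)
  simp [abs_of_nonneg (Finset.sum_nonneg fun a _ => abs_nonneg (H a ω))]

end Gaussian

section Expectation

variable {Ω S : Type*} [MeasurableSpace Ω] {P : Measure Ω}

lemma hasDerivAt_integral_of_forall_abs_le {F F' : ℝ → Ω → ℝ} {bound : Ω → ℝ}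
    (hF : ∀ x, Integrable (F x) P) (hF' : ∀ x, AEStronglyMeasurable (F' x) P)
    (hbound : ∀ᵐ ω ∂P, ∀ x, |F' x ω| ≤ bound ω) (hint : Integrable bound P)
    (hdiff : ∀ᵐ ω ∂P, ∀ x, HasDerivAt (fun y => F y ω) (F' x ω) x) (x : ℝ) :
    HasDerivAt (fun y => ∫ ω, F y ω ∂P) (∫ ω, F' x ω ∂P) x :=
  (hasDerivAt_integral_of_dominated_loc_of_deriv_le (s := Set.univ) Filter.univ_mem
    (Eventually.of_forall fun y => (hF y).aestronglyMeasurable) (hF x) (hF' x)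
    (hbound.mono fun _ h y _ => h y) hint (hdiff.mono fun _ h y _ => h y)).2

lemma integral_sum_mul_of_indepFun {ι : Type*} [Fintype ι] {W H : S → Ω → ℝ}
    (hindep : IndepFun (fun ω a => W a ω) (fun ω a => H a ω) P)
    {G K : ι → (S → ℝ) → ℝ} (hG : ∀ i, Measurable (G i)) (hK : ∀ i, Measurable (K i))
    (hGint : ∀ i, Integrable (fun ω => G i fun a => W a ω) P)
    (hKint : ∀ i, Integrable (fun ω => K i fun a => H a ω) P) :
    ∫ ω, ∑ i, (G i fun a => W a ω) * (K i fun a => H a ω) ∂P =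
      ∫ ω, ∑ i, (G i fun a => W a ω) * ∫ ω', (K i fun a => H a ω') ∂P ∂P := by
  have hind (i : ι) : IndepFun (fun ω => G i fun a => W a ω) (fun ω => K i fun a => H a ω) P :=
    hindep.comp (hG i) (hK i)
  have hGK (i : ι) : Integrable (fun ω => (G i fun a => W a ω) * (K i fun a => H a ω)) P :=
    (hind i).integrable_mul (hGint i) (hKint i)
  rw [integral_finsetSum _ fun i _ => hGK i,
    integral_finsetSum _ fun i _ => (hGint i).mul_const _]
  refine Finset.sum_congr rfl fun i _ => ?_
  rw [integral_mul_const]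
  exact (hind i).integral_fun_mul_eq_mul_integral (hGint i).aestronglyMeasurable
    (hKint i).aestronglyMeasurable

end Expectation

/-- In the random Gibbs/Gaussian setup, `φ(λ) = E[ln Σ_τ W_τ exp(λ H_τ)]` is four times
differentiable at `λ = 0`, with `φ''(0) = 1 − ⟨C₁₂⟩` and
`φ⁗(0) = −6(⟨C₁₂²⟩ − 4⟨C₁₂C₁₃⟩ + 3⟨C₁₂C₃₄⟩)`. -/
theorem phi_fourth_derivative
    {Ωs : Type*} [MeasurableSpace Ωs] (P : Measure Ωs) [IsProbabilityMeasure P]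
    {S : Type*} [Fintype S] [Nonempty S]
    (C : S → S → ℝ)
    (hsymm : ∀ a b, C a b = C b a)
    (hpsd : ∀ v : S → ℝ, 0 ≤ ∑ a : S, ∑ b : S, v a * v b * C a b)
    (hdiag : ∀ a, C a a = 1)
    (H : S → Ωs → ℝ) (hHmeas : ∀ a, Measurable (H a))
    (hGauss : ∀ v : S → ℝ,
      Measure.map (fun ω => ∑ a : S, v a * H a ω) P =
        gaussianReal 0 (Real.toNNReal (∑ a : S, ∑ b : S, v a * v b * C a b)))
    (W : S → Ωs → ℝ) (hWmeas : ∀ a, Measurable (W a))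
    (hW : ∀ᵐ ω ∂P, (∀ a, 0 ≤ W a ω) ∧ ∑ a : S, W a ω = 1)
    (hindep : IndepFun (fun ω a => W a ω) (fun ω a => H a ω) P)
    (φ : ℝ → ℝ)
    (hφ : ∀ lam : ℝ, φ lam = ∫ ω, Real.log (∑ τ : S, W τ ω * Real.exp (lam * H τ ω)) ∂P) :
    ∃ φ₁ φ₂ φ₃ : ℝ → ℝ, ∃ d₄ : ℝ,
      (∀ᶠ x in nhds (0 : ℝ), HasDerivAt φ (φ₁ x) x) ∧
      (∀ᶠ x in nhds (0 : ℝ), HasDerivAt φ₁ (φ₂ x) x) ∧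
      (∀ᶠ x in nhds (0 : ℝ), HasDerivAt φ₂ (φ₃ x) x) ∧
      HasDerivAt φ₃ d₄ 0 ∧
      φ₂ 0 = 1 - (∫ ω, ∑ τ₁ : S, ∑ τ₂ : S, W τ₁ ω * W τ₂ ω * C τ₁ τ₂ ∂P) ∧
      d₄ = -6 * ((∫ ω, ∑ τ₁ : S, ∑ τ₂ : S, W τ₁ ω * W τ₂ ω * (C τ₁ τ₂) ^ 2 ∂P)
        - 4 * (∫ ω, ∑ τ₁ : S, ∑ τ₂ : S, ∑ τ₃ : S,
            W τ₁ ω * W τ₂ ω * W τ₃ ω * (C τ₁ τ₂ * C τ₁ τ₃) ∂P)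
        + 3 * (∫ ω, ∑ τ₁ : S, ∑ τ₂ : S, ∑ τ₃ : S, ∑ τ₄ : S,
            W τ₁ ω * W τ₂ ω * W τ₃ ω * W τ₄ ω * (C τ₁ τ₂ * C τ₃ τ₄) ∂P)) := by
  have hWle : ∀ᵐ ω ∂P, ∀ a, |W a ω| ≤ 1 := by
    filter_upwards [hW] with ω hω a
    rw [abs_of_nonneg (hω.1 a), ← hω.2]
    exact Finset.single_le_sum (fun b _ => hω.1 b) (Finset.mem_univ a)
  have hprod {g : Ωs → ℝ} (hg : Integrable g P) (a : S) : Integrable (fun ω => g ω * W a ω) P :=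
    hg.mul_bdd (c := 1) (hWmeas a).aestronglyMeasurable (hWle.mono fun ω h => h a)
  have hW1 (a : S) : Integrable (fun ω => W a ω) P := by
    simpa using hprod (integrable_const (1 : ℝ)) a
  have hW2 (a b : S) : Integrable (fun ω => W a ω * W b ω) P := hprod (hW1 a) b
  have hW3 (a b c : S) : Integrable (fun ω => W a ω * W b ω * W c ω) P := hprod (hW2 a b) c
  have hW4 (a b c d : S) : Integrable (fun ω => W a ω * W b ω * W c ω * W d ω) P :=
    hprod (hW3 a b c) d
  have hB (n : ℕ) := integrable_sum_abs_pow hHmeas hGauss n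
  have hK2 (a b : S) := wick_two hsymm hpsd hHmeas hGauss a b
  have hK4 (a b c d : S) := wick_four hsymm hpsd hHmeas hGauss a b c d
  have hmom (k : ℕ) (x : ℝ) :
      Measurable fun ω => gibbsMoment (fun a => W a ω) (fun a => H a ω) k x := by
    unfold gibbsMoment
    fun_prop
  have hvar (x : ℝ) : Measurable fun ω => gibbsVariance (fun a => W a ω) (fun a => H a ω) x := by
    unfold gibbsVariance
    fun_prop
  have hthird (x : ℝ) :
      Measurable fun ω => gibbsThirdCumulant (fun a => W a ω) (fun a => H a ω) x := by
    unfold gibbsThirdCumulant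
    fun_prop
  have hfourth (x : ℝ) :
      Measurable fun ω => gibbsFourthCumulant (fun a => W a ω) (fun a => H a ω) x := by
    unfold gibbsFourthCumulant
    fun_prop
  have hb1 : ∀ᵐ ω ∂P, ∀ x, |gibbsMoment (fun a => W a ω) (fun a => H a ω) 1 x| ≤
      (∑ a, |H a ω|) ^ 1 := hW.mono fun ω h x => abs_gibbsMoment_le h.1 h.2 1 x
  have hb2 : ∀ᵐ ω ∂P, ∀ x, |gibbsVariance (fun a => W a ω) (fun a => H a ω) x| ≤
      2 * (∑ a, |H a ω|) ^ 2 := hW.mono fun ω h x => abs_gibbsVariance_le h.1 h.2 x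
  have hb3 : ∀ᵐ ω ∂P, ∀ x, |gibbsThirdCumulant (fun a => W a ω) (fun a => H a ω) x| ≤
      6 * (∑ a, |H a ω|) ^ 3 := hW.mono fun ω h x => abs_gibbsThirdCumulant_le h.1 h.2 x
  have hb4 : ∀ᵐ ω ∂P, ∀ x, |gibbsFourthCumulant (fun a => W a ω) (fun a => H a ω) x| ≤
      26 * (∑ a, |H a ω|) ^ 4 := hW.mono fun ω h x => abs_gibbsFourthCumulant_le h.1 h.2 x
  have hlog (x : ℝ) : Integrable (fun ω => Real.log (∑ a, W a ω * Real.exp (x * H a ω))) P := by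
    refine ((hB 1).const_mul |x|).mono'
      (by fun_prop : Measurable _).aestronglyMeasurable (hW.mono fun ω h => ?_)
    simpa using abs_log_partition_le h.1 h.2 x
  obtain rfl : φ = fun x => ∫ ω, Real.log (∑ a, W a ω * Real.exp (x * H a ω)) ∂P := funext hφ
  refine ⟨fun x => ∫ ω, gibbsMoment (fun a => W a ω) (fun a => H a ω) 1 x ∂P,
    fun x => ∫ ω, gibbsVariance (fun a => W a ω) (fun a => H a ω) x ∂P,
    fun x => ∫ ω, gibbsThirdCumulant (fun a => W a ω) (fun a => H a ω) x ∂P,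
    ∫ ω, gibbsFourthCumulant (fun a => W a ω) (fun a => H a ω) 0 ∂P,
    Eventually.of_forall fun x => ?_, Eventually.of_forall fun x => ?_,
    Eventually.of_forall fun x => ?_, ?_, ?_, ?_⟩
  · exact hasDerivAt_integral_of_forall_abs_le hlog
      (fun y => (hmom 1 y).aestronglyMeasurable) hb1 (hB 1)
      (hW.mono fun ω h y => hasDerivAt_log_partition h.1 h.2 y) x
  · exact hasDerivAt_integral_of_forall_abs_le
      (fun y => (hB 1).mono' (hmom 1 y).aestronglyMeasurable (hb1.mono fun ω h => h y))
      (fun y => (hvar y).aestronglyMeasurable) hb2 ((hB 2).const_mul 2)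
      (hW.mono fun ω h y => hasDerivAt_gibbsMoment_one h.1 h.2 y) x
  · exact hasDerivAt_integral_of_forall_abs_le
      (fun y => ((hB 2).const_mul 2).mono' (hvar y).aestronglyMeasurable
        (hb2.mono fun ω h => h y))
      (fun y => (hthird y).aestronglyMeasurable) hb3 ((hB 3).const_mul 6)
      (hW.mono fun ω h y => hasDerivAt_gibbsVariance h.1 h.2 y) x
  · exact hasDerivAt_integral_of_forall_abs_le
      (fun y => ((hB 3).const_mul 6).mono' (hthird y).aestronglyMeasurable
        (hb3.mono fun ω h => h y))
      (fun y => (hfourth y).aestronglyMeasurable) hb4 ((hB 4).const_mul 26)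
      (hW.mono fun ω h y => hasDerivAt_gibbsThirdCumulant h.1 h.2 y) 0
  · have hrep := integral_sum_mul_of_indepFun (ι := S × S) hindep
      (G := fun p w => w p.1 * w p.2) (K := fun p h => h p.1 * h p.1 - h p.1 * h p.2)
      (fun _ => by fun_prop) (fun _ => by fun_prop) (fun p => hW2 _ _)
      (fun p => (hK2 _ _).1.sub (hK2 _ _).1)
    have hwick (a b : S) : ∫ ω, (H a ω * H a ω - H a ω * H b ω) ∂P = 1 - C a b := by
      rw [integral_sub (hK2 _ _).1 (hK2 _ _).1, (hK2 _ _).2, (hK2 _ _).2, hdiag]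
    simp only [Fintype.sum_prod_type, hwick] at hrep
    have hint : Integrable (fun ω => ∑ a, ∑ b, W a ω * W b ω * C a b) P :=
      integrable_finsetSum _ fun a _ => integrable_finsetSum _ fun b _ =>
        (hW2 a b).mul_const _
    calc _ = ∫ ω, ∑ a, ∑ b, W a ω * W b ω * (H a ω * H a ω - H a ω * H b ω) ∂P :=
          integral_congr_ae (hW.mono fun ω h => gibbsVariance_zero h.2)
      _ = ∫ ω, ∑ a, ∑ b, W a ω * W b ω * (1 - C a b) ∂P := hrep
      _ = ∫ ω, (1 - ∑ a, ∑ b, W a ω * W b ω * C a b) ∂P := by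
        refine integral_congr_ae (hW.mono fun ω h => ?_)
        simp only [mul_sub, Finset.sum_sub_distrib, mul_one, ← Finset.mul_sum, h.2]
      _ = _ := by
        rw [integral_sub (integrable_const _) hint]
        simp
  · have hI (a b c d : S) : Integrable (fun ω => H a ω * H a ω * H a ω * H a ω -
        4 * (H b ω * H b ω * H b ω * H c ω) - 3 * (H a ω * H a ω * H b ω * H b ω) +
        12 * (H a ω * H a ω * H b ω * H c ω) - 6 * (H a ω * H b ω * H c ω * H d ω)) P :=
      (((((hK4 _ _ _ _).1.sub ((hK4 _ _ _ _).1.const_mul 4)).sub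
        ((hK4 _ _ _ _).1.const_mul 3)).add ((hK4 _ _ _ _).1.const_mul 12)).sub
        ((hK4 _ _ _ _).1.const_mul 6))
    have hrep := integral_sum_mul_of_indepFun (ι := S × S × S × S) hindep
      (G := fun p w => w p.1 * w p.2.1 * w p.2.2.1 * w p.2.2.2)
      (K := fun p h => h p.1 * h p.1 * h p.1 * h p.1 -
        4 * (h p.2.1 * h p.2.1 * h p.2.1 * h p.2.2.1) -
        3 * (h p.1 * h p.1 * h p.2.1 * h p.2.1) +
        12 * (h p.1 * h p.1 * h p.2.1 * h p.2.2.1) -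
        6 * (h p.1 * h p.2.1 * h p.2.2.1 * h p.2.2.2))
      (fun _ => by fun_prop) (fun _ => by fun_prop) (fun p => hW4 _ _ _ _)
      (fun p => hI _ _ _ _)
    have hwick (a b c d : S) : ∫ ω, (H a ω * H a ω * H a ω * H a ω -
        4 * (H b ω * H b ω * H b ω * H c ω) - 3 * (H a ω * H a ω * H b ω * H b ω) +
        12 * (H a ω * H a ω * H b ω * H c ω) - 6 * (H a ω * H b ω * H c ω * H d ω)) ∂P =
        -6 * C a b ^ 2 + 24 * (C a b * C a c) -
          6 * (C a b * C c d + C a c * C b d + C a d * C b c) := by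
      have h1 := (hK4 a a a a).1.sub' ((hK4 b b b c).1.const_mul 4)
      have h2 := h1.sub' ((hK4 a a b b).1.const_mul 3)
      have h3 := h2.fun_add ((hK4 a a b c).1.const_mul 12)
      rw [integral_sub h3 ((hK4 a b c d).1.const_mul 6),
        integral_add h2 ((hK4 a a b c).1.const_mul 12),
        integral_sub h1 ((hK4 a a b b).1.const_mul 3),
        integral_sub (hK4 a a a a).1 ((hK4 b b b c).1.const_mul 4)]
      simp only [integral_const_mul, (hK4 _ _ _ _).2, hdiag]
      ring
    simp only [Fintype.sum_prod_type, hwick] at hrep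
    have hint2 : Integrable (fun ω => ∑ a, ∑ b, W a ω * W b ω * C a b ^ 2) P :=
      integrable_finsetSum _ fun a _ => integrable_finsetSum _ fun b _ =>
        (hW2 a b).mul_const _
    have hint3 : Integrable (fun ω => ∑ a, ∑ b, ∑ c,
        W a ω * W b ω * W c ω * (C a b * C a c)) P :=
      integrable_finsetSum _ fun a _ => integrable_finsetSum _ fun b _ =>
        integrable_finsetSum _ fun c _ => (hW3 a b c).mul_const _
    have hint4 : Integrable (fun ω => ∑ a, ∑ b, ∑ c, ∑ d,
        W a ω * W b ω * W c ω * W d ω * (C a b * C c d)) P :=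
      integrable_finsetSum _ fun a _ => integrable_finsetSum _ fun b _ =>
        integrable_finsetSum _ fun c _ => integrable_finsetSum _ fun d _ =>
          (hW4 a b c d).mul_const _
    rw [← integral_const_mul 4, ← integral_const_mul 3,
      ← integral_sub hint2 (hint3.const_mul 4),
      ← integral_add (hint2.sub' (hint3.const_mul 4)) (hint4.const_mul 3),
      ← integral_const_mul]
    exact ((integral_congr_ae (hW.mono fun ω h => gibbsFourthCumulant_zero h.2)).trans
      hrep).trans (integral_congr_ae (hW.mono fun ω h => sum_wick_fourthCumulant C h.2))
end
end
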